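/- arXiv:2604.09741 — 2 statements merged into one kernel-verified Lean document; each statement's English description precedes it below -/
import Mathlib

section
/- (Finite-horizon simulation lemma.) In a finite-horizon MDP with rewards in [0, R_max] and horizon H, for any two policies π₁ and π₂ and any initial state s₀: V_H^{π₁}(s₀) − V_H^{π₂}(s₀) ≤ 2·H·R_max · ∑_{t=0}^{H−1} E_{s∼d_{π₁,t}}[ TV(π₁(·∣s), π₂(·∣s)) ]. -/
/-- A finite-horizon MDP with finite state and action spaces: a transition kernel `P`
(given as a probability mass function over next states), and a reward function `r`
with values in `[0, Rmax]`. -/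
structure FinMDP (S A : Type) [Fintype S] [Fintype A] where
  P : S → A → S → ℝ
  P_nonneg : ∀ s a s', 0 ≤ P s a s'
  P_sum : ∀ s a, ∑ s', P s a s' = 1
  r : S → A → ℝ
  Rmax : ℝ
  r_nonneg : ∀ s a, 0 ≤ r s a
  r_le_Rmax : ∀ s a, r s a ≤ Rmax

variable {S A : Type} [Fintype S] [Fintype A]

/-- A policy assigns to each state a probability mass function over actions. -/
def IsPolicy (π : S → A → ℝ) : Prop :=
  (∀ s a, 0 ≤ π s a) ∧ ∀ s, ∑ a, π s a = 1

/-- The `n`-step value function: `V 0 s = 0` and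
`V (n+1) s = E_{a∼π(s)}[r s a + E_{s'∼P(s,a)}[V n s']]`. -/
def FinMDP.V (M : FinMDP S A) (π : S → A → ℝ) : ℕ → S → ℝ
  | 0, _ => 0
  | n + 1, s => ∑ a, π s a * (M.r s a + ∑ s', M.P s a s' * M.V π n s')

/-- The state-visitation distribution at time `t`, starting from `s₀`. -/
def FinMDP.visit [DecidableEq S] (M : FinMDP S A) (π : S → A → ℝ) (s₀ : S) : ℕ → S → ℝ
  | 0, s => if s = s₀ then 1 else 0
  | t + 1, s' => ∑ s, M.visit π s₀ t s * ∑ a, π s a * M.P s a s'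

lemma FinMDP.V_bounds (M : FinMDP S A) (π : S → A → ℝ) (h : IsPolicy π) (n : ℕ) :
    ∀ s, 0 ≤ M.V π n s ∧ M.V π n s ≤ n * M.Rmax := by
  induction n with
  | zero => intro s; simp [FinMDP.V]
  | succ n ih =>
    intro s
    have hP0 : ∀ a, 0 ≤ ∑ s', M.P s a s' * M.V π n s' := fun a =>
      Finset.sum_nonneg fun s' _ => mul_nonneg (M.P_nonneg _ _ _) (ih s').1
    have hP1 : ∀ a, ∑ s', M.P s a s' * M.V π n s' ≤ n * M.Rmax := fun a => by
      calc _ ≤ ∑ s', M.P s a s' * (n * M.Rmax) :=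
            Finset.sum_le_sum fun s' _ =>
              mul_le_mul_of_nonneg_left (ih s').2 (M.P_nonneg _ _ _)
        _ = _ := by rw [← Finset.sum_mul, M.P_sum, one_mul]
    simp only [FinMDP.V]
    constructor
    · exact Finset.sum_nonneg fun a _ =>
        mul_nonneg (h.1 _ _) (add_nonneg (M.r_nonneg _ _) (hP0 a))
    · calc _ ≤ ∑ a, π s a * (((n + 1 : ℕ) : ℝ) * M.Rmax) :=
            Finset.sum_le_sum fun a _ =>
              mul_le_mul_of_nonneg_left
                (by push_cast; linarith [hP1 a, M.r_le_Rmax s a]) (h.1 _ _)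
        _ = _ := by rw [← Finset.sum_mul, h.2, one_mul]

lemma FinMDP.visit_nonneg [DecidableEq S] (M : FinMDP S A) (π : S → A → ℝ) (h : IsPolicy π)
    (s₀ : S) (t : ℕ) : ∀ s, 0 ≤ M.visit π s₀ t s := by
  induction t with
  | zero => intro s; simp only [FinMDP.visit]; split_ifs <;> norm_num
  | succ t ih =>
    intro s
    simp only [FinMDP.visit]
    exact Finset.sum_nonneg fun s' _ => mul_nonneg (ih s')
      (Finset.sum_nonneg fun a _ => mul_nonneg (h.1 _ _) (M.P_nonneg _ _ _))

lemma FinMDP.step (M : FinMDP S A) (π₁ π₂ : S → A → ℝ) (h₂ : IsPolicy π₂) (n : ℕ) (s : S) :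
    M.V π₁ (n + 1) s - M.V π₂ (n + 1) s ≤
      ((n + 1 : ℕ) : ℝ) * M.Rmax * ∑ a, |π₁ s a - π₂ s a| +
      ∑ a, π₁ s a * ∑ s', M.P s a s' * (M.V π₁ n s' - M.V π₂ n s') := by
  simp only [FinMDP.V]
  rw [← Finset.sum_sub_distrib, Finset.mul_sum, ← Finset.sum_add_distrib]
  refine Finset.sum_le_sum fun a _ => ?_
  have hb := M.V_bounds π₂ h₂ n
  have hP0 : 0 ≤ ∑ s', M.P s a s' * M.V π₂ n s' :=
    Finset.sum_nonneg fun s' _ => mul_nonneg (M.P_nonneg _ _ _) (hb s').1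
  have hP1 : ∑ s', M.P s a s' * M.V π₂ n s' ≤ n * M.Rmax := by
    calc _ ≤ ∑ s', M.P s a s' * (n * M.Rmax) :=
          Finset.sum_le_sum fun s' _ =>
            mul_le_mul_of_nonneg_left (hb s').2 (M.P_nonneg _ _ _)
      _ = _ := by rw [← Finset.sum_mul, M.P_sum, one_mul]
  simp only [mul_sub, Finset.sum_sub_distrib]
  have hr0 := M.r_nonneg s a
  have hr1 := M.r_le_Rmax s a
  set x := ∑ s', M.P s a s' * M.V π₂ n s'
  have h1 : (π₁ s a - π₂ s a) * (M.r s a + x) ≤ |π₁ s a - π₂ s a| * (M.r s a + x) :=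
    mul_le_mul_of_nonneg_right (le_abs_self _) (by linarith)
  have h2 : |π₁ s a - π₂ s a| * (M.r s a + x) ≤
      |π₁ s a - π₂ s a| * (((n + 1 : ℕ) : ℝ) * M.Rmax) :=
    mul_le_mul_of_nonneg_left (by push_cast; linarith) (abs_nonneg _)
  linarith

lemma FinMDP.visit_push [DecidableEq S] (M : FinMDP S A) (π : S → A → ℝ) (s₀ : S) (t : ℕ)
    (f : S → ℝ) :
    ∑ s, M.visit π s₀ t s * ∑ a, π s a * ∑ s', M.P s a s' * f s' =
      ∑ s', M.visit π s₀ (t + 1) s' * f s' := by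
  simp only [FinMDP.visit, Finset.sum_mul, Finset.mul_sum]
  conv_rhs => rw [Finset.sum_comm]
  refine Finset.sum_congr rfl fun s _ => ?_
  rw [Finset.sum_comm]
  refine Finset.sum_congr rfl fun s' _ => Finset.sum_congr rfl fun a _ => by ring

lemma FinMDP.unroll [DecidableEq S] (M : FinMDP S A) (π₁ π₂ : S → A → ℝ)
    (h₁ : IsPolicy π₁) (h₂ : IsPolicy π₂) (hR : 0 ≤ M.Rmax) (H : ℕ) (s₀ : S) (k : ℕ) :
    ∀ n, n + k = H → M.V π₁ H s₀ - M.V π₂ H s₀ ≤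
      (∑ t ∈ Finset.range k, ∑ s,
          M.visit π₁ s₀ t s * (H * M.Rmax * ∑ a, |π₁ s a - π₂ s a|)) +
      ∑ s, M.visit π₁ s₀ k s * (M.V π₁ n s - M.V π₂ n s) := by
  induction k with
  | zero => rintro n rfl; simp [FinMDP.visit]
  | succ k ih =>
    intro n hn
    refine (ih (n + 1) (by omega)).trans ?_
    rw [Finset.sum_range_succ, add_assoc, ← M.visit_push, ← Finset.sum_add_distrib]
    refine add_le_add le_rfl (Finset.sum_le_sum fun s _ => ?_)
    rw [← mul_add]
    refine mul_le_mul_of_nonneg_left ?_ (M.visit_nonneg π₁ h₁ s₀ k s)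
    refine (M.step π₁ π₂ h₂ n s).trans ?_
    have : ((n + 1 : ℕ) : ℝ) ≤ H := by exact_mod_cast (by omega : n + 1 ≤ H)
    gcongr

/-- **Finite-horizon simulation lemma.** For any two policies `π₁, π₂`
and any initial state `s₀`,
`V_H^{π₁}(s₀) − V_H^{π₂}(s₀) ≤ 2·H·Rmax · ∑_{t<H} E_{s∼d_{π₁,t}}[TV(π₁(·∣s), π₂(·∣s))]`. -/
theorem stmt_4 [DecidableEq S] (M : FinMDP S A) (π₁ π₂ : S → A → ℝ)
    (h₁ : IsPolicy π₁) (h₂ : IsPolicy π₂) (H : ℕ) (s₀ : S) :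
    M.V π₁ H s₀ - M.V π₂ H s₀ ≤
      2 * H * M.Rmax *
        ∑ t ∈ Finset.range H, ∑ s,
          M.visit π₁ s₀ t s * ((1 / 2) * ∑ a, |π₁ s a - π₂ s a|) := by
  have hR : 0 ≤ M.Rmax := by
    have : Nonempty A := by
      by_contra hA
      rw [not_nonempty_iff] at hA
      have := h₁.2 s₀
      simp at this
    obtain ⟨a⟩ := this
    exact (M.r_nonneg s₀ a).trans (M.r_le_Rmax s₀ a)
  refine (M.unroll π₁ π₂ h₁ h₂ hR H s₀ H 0 (by omega)).trans (le_of_eq ?_)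
  simp only [FinMDP.V, sub_self, mul_zero, Finset.sum_const_zero, add_zero]
  rw [Finset.mul_sum]
  refine Finset.sum_congr rfl fun t _ => ?_
  rw [Finset.mul_sum]
  refine Finset.sum_congr rfl fun s _ => by ring
end

section
/- (Accepted strategies have high expected success.) Let Z be a countable strategy space, π_L a probability mass function on Z, q : Z → [0,1], K ≥ 1, τ ∈ (0,1], and η with 0 < η < τ. Let p_acc(z) = Pr_{X∼Binomial(K, q(z))}(X ≥ Kτ), assume the acceptance rate A = ∑_z π_L(z)·p_acc(z) is positive, and let π_acc(z) = π_L(z)·p_acc(z)/A. Then the expected success probability under the accepted distribution satisfies ∑_z π_acc(z)·q(z) ≥ (τ − η)·(1 − e^{−2Kη²}/A). -/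
/-- The probability that `Binomial(K, p)` equals `k`:
the law of the number of successes in `K` independent Bernoulli(`p`) trials. -/
def binomPMF (K : ℕ) (p : ℝ) (k : ℕ) : ℝ :=
  (K.choose k : ℝ) * p ^ k * (1 - p) ^ (K - k)

/-- `Pr_{X∼Binomial(K,p)}(X ≥ K·τ)`: the upper tail of the binomial at threshold `K·τ`. -/
noncomputable def binomTail (K : ℕ) (p τ : ℝ) : ℝ :=
  ∑ k ∈ Finset.range (K + 1), if (K : ℝ) * τ ≤ (k : ℝ) then binomPMF K p k else 0

open MeasureTheory ProbabilityTheory in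
lemma bern_mgf (p t : ℝ) (hp0 : 0 ≤ p) (hp1 : p ≤ 1) :
    1 - p + p * Real.exp t ≤ Real.exp (t * p + t ^ 2 / 8) := by
  let μ : Measure ℝ := ENNReal.ofReal p • Measure.dirac 1 + ENNReal.ofReal (1 - p) • Measure.dirac 0
  have hμ : IsProbabilityMeasure μ := by
    constructor
    simp only [μ, Measure.add_apply, Measure.smul_apply, measure_univ, smul_eq_mul, mul_one]
    rw [← ENNReal.ofReal_add hp0 (by linarith)]
    simp
  have hint : ∀ f : ℝ → ℝ, ∫ x, f x ∂μ = p * f 1 + (1 - p) * f 0 := by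
    intro f
    have hi : ∀ a : ℝ, Integrable f (Measure.dirac a) := fun a =>
      integrable_dirac (by simp)
    rw [integral_add_measure ((hi 1).smul_measure (by simp)) ((hi 0).smul_measure (by simp)),
      integral_smul_measure, integral_smul_measure]
    simp [hp0, hp1]
  have hb : ∀ᵐ x ∂μ, (fun x : ℝ => x) x ∈ Set.Icc (0:ℝ) 1 := by
    rw [ae_add_measure_iff]
    constructor
    · apply Measure.ae_smul_measure
      rw [ae_dirac_eq]; simp
    · apply Measure.ae_smul_measure
      rw [ae_dirac_eq]; simp
  have h := (hasSubgaussianMGF_of_mem_Icc (μ := μ) (X := fun x : ℝ => x) (by fun_prop) hb).mgf_le t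
  have hm : ∫ x, x ∂μ = p := by rw [hint (fun x => x)]; simp
  simp only [mgf] at h
  rw [hm, hint (fun x => Real.exp (t * (x - p)))] at h
  have e : ((((‖(1:ℝ) - 0‖₊ / 2) ^ 2 : NNReal) : ℝ)) * t ^ 2 / 2 = t ^ 2 / 8 := by
    simp; ring
  rw [e] at h
  have h2 := mul_le_mul_of_nonneg_left h (Real.exp_pos (t * p)).le
  rw [← Real.exp_add] at h2
  refine le_trans (le_of_eq ?_) h2
  have e1 : Real.exp (t * (1 - p)) = Real.exp t / Real.exp (t * p) := by
    rw [← Real.exp_sub]; ring_nf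
  have e2 : Real.exp (t * (0 - p)) = 1 / Real.exp (t * p) := by
    rw [← Real.exp_zero, ← Real.exp_sub]; ring_nf
  rw [e1, e2]
  have := (Real.exp_pos (t * p)).ne'
  field_simp
  ring

lemma binomPMF_nn (K : ℕ) (p : ℝ) (k : ℕ) (hp0 : 0 ≤ p) (hp1 : p ≤ 1) : 0 ≤ binomPMF K p k := by
  have : 0 ≤ 1 - p := by linarith
  unfold binomPMF; positivity

lemma binomTail_nn (K : ℕ) (p τ : ℝ) (hp0 : 0 ≤ p) (hp1 : p ≤ 1) : 0 ≤ binomTail K p τ := by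
  unfold binomTail
  refine Finset.sum_nonneg fun k _ => ?_
  split_ifs
  · exact binomPMF_nn K p k hp0 hp1
  · exact le_rfl

lemma binomTail_chernoff (K : ℕ) (p τ t : ℝ) (hp0 : 0 ≤ p) (hp1 : p ≤ 1) (ht : 0 ≤ t) :
    binomTail K p τ ≤ Real.exp (-(t * (K * τ))) * (1 - p + p * Real.exp t) ^ K := by
  have e : (1 - p + p * Real.exp t) ^ K
      = ∑ k ∈ Finset.range (K + 1), binomPMF K p k * Real.exp (t * k) := by
    rw [add_comm, add_pow]
    refine Finset.sum_congr rfl fun k _ => ?_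
    rw [mul_comm t, Real.exp_nat_mul, mul_pow]
    unfold binomPMF; ring
  rw [e, Finset.mul_sum]
  unfold binomTail
  refine Finset.sum_le_sum fun k _ => ?_
  have hn := binomPMF_nn K p k hp0 hp1
  split_ifs with h
  · have : 1 ≤ Real.exp (-(t * (K * τ))) * Real.exp (t * k) := by
      rw [← Real.exp_add]
      apply Real.one_le_exp
      nlinarith [mul_le_mul_of_nonneg_left h ht]
    nlinarith
  · positivity

lemma binomTail_hoeffding (K : ℕ) (p τ η : ℝ) (hp0 : 0 ≤ p) (hp1 : p ≤ 1) (hη : 0 < η)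
    (h : p ≤ τ - η) : binomTail K p τ ≤ Real.exp (-2 * K * η ^ 2) := by
  refine (binomTail_chernoff K p τ (4 * η) hp0 hp1 (by linarith)).trans ?_
  have hb := bern_mgf p (4 * η) hp0 hp1
  have h0 : 0 ≤ 1 - p + p * Real.exp (4 * η) := by
    have : 0 ≤ 1 - p := by linarith
    positivity
  refine (mul_le_mul_of_nonneg_left (pow_le_pow_left₀ h0 hb K) (Real.exp_pos _).le).trans ?_
  rw [← Real.exp_nat_mul, ← Real.exp_add]
  apply Real.exp_le_exp.mpr
  have hK : (0:ℝ) ≤ K := Nat.cast_nonneg K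
  have : 0 ≤ (K:ℝ) * (η * (τ - η - p)) :=
    mul_nonneg hK (mul_nonneg hη.le (by linarith))
  nlinarith

/-- **Accepted strategies have high expected success.** With acceptance
probability `p_acc(z) = Pr_{X∼Binomial(K, q z)}(X ≥ Kτ)`, positive acceptance rate `A`,
and accepted distribution `π_acc(z) = π_L(z)·p_acc(z)/A`, the expected success
probability satisfies `∑_z π_acc(z)·q(z) ≥ (τ − η)·(1 − e^{−2Kη²}/A)`. -/
theorem stmt_11 {Z : Type*} [Countable Z]
    (πL : Z → ℝ) (h0 : ∀ z, 0 ≤ πL z) (h1 : ∑' z, πL z = 1)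
    (q : Z → ℝ) (hq0 : ∀ z, 0 ≤ q z) (hq1 : ∀ z, q z ≤ 1)
    (K : ℕ) (hK : 1 ≤ K) (τ η : ℝ)
    (hτ0 : 0 < τ) (hτ1 : τ ≤ 1) (hη0 : 0 < η) (hητ : η < τ)
    (pacc : Z → ℝ) (hpacc : ∀ z, pacc z = binomTail K (q z) τ)
    (A : ℝ) (hA : A = ∑' z, πL z * pacc z) (hApos : 0 < A)
    (πacc : Z → ℝ) (hπacc : ∀ z, πacc z = πL z * pacc z / A) :
    (τ - η) * (1 - Real.exp (-2 * K * η ^ 2) / A) ≤ ∑' z, πacc z * q z := by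
  have hS : Summable πL := by
    by_contra hc
    rw [tsum_eq_zero_of_not_summable hc] at h1
    exact zero_ne_one h1
  have hp0 : ∀ z, 0 ≤ pacc z := fun z => by
    rw [hpacc]; exact binomTail_nn _ _ _ (hq0 z) (hq1 z)
  have hp1 : ∀ z, pacc z ≤ 1 := fun z => by
    rw [hpacc]
    refine (binomTail_chernoff K (q z) τ 0 (hq0 z) (hq1 z) le_rfl).trans ?_
    simp
  have hSp : Summable fun z => πL z * pacc z :=
    Summable.of_nonneg_of_le (fun z => mul_nonneg (h0 z) (hp0 z))
      (fun z => mul_le_of_le_one_right (h0 z) (hp1 z)) hS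
  have hSq : Summable fun z => πL z * pacc z * q z :=
    Summable.of_nonneg_of_le (fun z => mul_nonneg (mul_nonneg (h0 z) (hp0 z)) (hq0 z))
      (fun z => mul_le_of_le_one_right (mul_nonneg (h0 z) (hp0 z)) (hq1 z)) hSp
  set E := Real.exp (-2 * K * η ^ 2) with hE
  have hEpos : 0 < E := Real.exp_pos _
  have key : ∀ z, (τ - η) * (πL z * pacc z - πL z * E) ≤ πL z * pacc z * q z := by
    intro z
    have hd : 0 < τ - η := by linarith
    have hn := mul_nonneg (h0 z) (hp0 z)
    rcases le_total (τ - η) (q z) with h | h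
    · have a := mul_le_mul_of_nonneg_left h hn
      have b := mul_nonneg hd.le (mul_nonneg (h0 z) hEpos.le)
      nlinarith
    · have hh : pacc z ≤ E := by
        rw [hpacc]; exact binomTail_hoeffding K (q z) τ η (hq0 z) (hq1 z) hη0 h
      have a := mul_le_mul_of_nonneg_left hh (h0 z)
      have b := mul_nonneg hd.le (sub_nonneg.mpr a)
      have c := mul_nonneg hn (hq0 z)
      nlinarith
  have hsum := Summable.tsum_le_tsum key ((hSp.sub (hS.mul_right E)).mul_left _) hSq
  rw [tsum_mul_left, hSp.tsum_sub (hS.mul_right E), tsum_mul_right, h1, ← hA, one_mul] at hsum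
  have e : ∑' z, πacc z * q z = (∑' z, πL z * pacc z * q z) / A := by
    rw [← tsum_div_const]
    refine tsum_congr fun z => ?_
    rw [hπacc]; ring
  rw [e, le_div_iff₀ hApos]
  refine le_trans (le_of_eq ?_) hsum
  field_simp
end
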